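/- Let D = (V, E) be a finite directed graph and S ⊆ V a target set, and let D' be the associated capacity network with lower and upper bounds: its vertex set is {vⁱⁿ, vᵒᵘᵗ : v ∈ V} ∪ {v_s, v_t}; its edges and bounds [l, c] are (vᵢᵒᵘᵗ, vⱼⁱⁿ) with [0,1] for each (vᵢ, vⱼ) ∈ E, (vⁱⁿ, vᵒᵘᵗ) with [1,1] for v ∈ S and [0,1] for v ∉ S, (v_s, vⁱⁿ) with [0,1] and (vᵒᵘᵗ, v_t) with [0,1] for each v ∈ V, and (v_t, v_s) with lower bound 0 and no upper bound. Let f be an integral feasible circulation of D' (all flow values are natural numbers) and define E^(F) = {(vᵢ, vⱼ) ∈ E : f((vᵢᵒᵘᵗ, vⱼⁱⁿ)) = 1}. Then in the directed graph (V, E^(F)) every vertex has at most one outgoing edge and at most one incoming edge. -/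

import Mathlib

/-- Vertices of the associated capacity network `D'`: for each original vertex `v` an
in-copy `vⁱⁿ` and an out-copy `vᵒᵘᵗ`, plus a source `v_s` (`src`) and a sink `v_t`
(`snk`). -/
inductive Node (V : Type*) where
  | inn : V → Node V
  | out : V → Node V
  | src : Node V
  | snk : Node V
deriving DecidableEq, Fintype

/-- The edges of the capacity network `D'` associated to the directed graph `(V, E)`
and target set `S`: `(vᵢᵒᵘᵗ, vⱼⁱⁿ)` for each original edge `(vᵢ, vⱼ) ∈ E`, the split
edge `(vⁱⁿ, vᵒᵘᵗ)` for each `v ∈ V`, the edges `(v_s, vⁱⁿ)` and `(vᵒᵘᵗ, v_t)` for each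
`v ∈ V`, and the return edge `(v_t, v_s)`. -/
def IsEdge {V : Type*} (E : Finset (V × V)) : Node V → Node V → Prop
  | .out v, .inn w => (v, w) ∈ E
  | .inn v, .out w => v = w
  | .src, .inn _ => True
  | .out _, .snk => True
  | .snk, .src => True
  | _, _ => False

/-- A feasible circulation of the capacity network `D'`: a nonnegative flow supported on
the edges of `D'`, respecting the lower bound `1` on split edges `(vⁱⁿ, vᵒᵘᵗ)` of target
vertices `v ∈ S`, the upper bound `1` on every edge except the unbounded return edge
`(v_t, v_s)`, and flow conservation at every vertex. -/
structure IsFeasibleCirculation {V : Type*} [Fintype V] [DecidableEq V]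
    (E : Finset (V × V)) (S : Finset V) (f : Node V → Node V → ℝ) : Prop where
  support : ∀ x y : Node V, ¬ IsEdge E x y → f x y = 0
  nonneg : ∀ x y : Node V, 0 ≤ f x y
  cap_edge : ∀ v w : V, (v, w) ∈ E → f (.out v) (.inn w) ≤ 1
  cap_split : ∀ v : V, f (.inn v) (.out v) ≤ 1
  lb_split : ∀ v ∈ S, 1 ≤ f (.inn v) (.out v)
  cap_src : ∀ v : V, f .src (.inn v) ≤ 1
  cap_snk : ∀ v : V, f (.out v) .snk ≤ 1
  conserve : ∀ x : Node V, ∑ y : Node V, f y x = ∑ y : Node V, f x y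

/-- A circulation is integral if all its flow values are natural numbers. -/
def IsIntegralFlow {V : Type*} (f : Node V → Node V → ℝ) : Prop :=
  ∀ x y : Node V, ∃ n : ℕ, f x y = n

namespace IsFeasibleCirculation

variable {V : Type*} [Fintype V] [DecidableEq V] {E : Finset (V × V)} {S : Finset V}
  {f : Node V → Node V → ℝ}

/-- The total flow into `vᵒᵘᵗ` is the flow along the split edge of `v`. -/
lemma sum_to_out (hf : IsFeasibleCirculation E S f) (v : V) :
    ∑ y : Node V, f y (.out v) = f (.inn v) (.out v) := by
  refine Fintype.sum_eq_single _ fun y hy => hf.support _ _ ?_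
  cases y <;> simp_all [IsEdge]

/-- The total flow out of `vⁱⁿ` is the flow along the split edge of `v`. -/
lemma sum_from_inn (hf : IsFeasibleCirculation E S f) (v : V) :
    ∑ y : Node V, f (.inn v) y = f (.inn v) (.out v) := by
  refine Fintype.sum_eq_single _ fun y hy => hf.support _ _ ?_
  cases y <;> simp_all [IsEdge, eq_comm]

lemma sum_from_out_le_one (hf : IsFeasibleCirculation E S f) (v : V) :
    ∑ y : Node V, f (.out v) y ≤ 1 := by
  rw [← hf.conserve, hf.sum_to_out]
  exact hf.cap_split v

lemma sum_to_inn_le_one (hf : IsFeasibleCirculation E S f) (v : V) :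
    ∑ y : Node V, f y (.inn v) ≤ 1 := by
  rw [hf.conserve, hf.sum_from_inn]
  exact hf.cap_split v

end IsFeasibleCirculation

/-- A nonnegative function with total at most `1` takes the value `1` at most once. -/
lemma eq_of_eq_one_of_sum_le_one {ι : Type*} [Fintype ι] {g : ι → ℝ} (hg : ∀ i, 0 ≤ g i)
    (hsum : ∑ i, g i ≤ 1) {a b : ι} (ha : g a = 1) (hb : g b = 1) : a = b := by
  classical
  by_contra hab
  have hpair : ∑ i ∈ {a, b}, g i ≤ ∑ i, g i :=
    Finset.sum_le_univ_sum_of_nonneg hg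
  rw [Finset.sum_pair hab] at hpair
  linarith

/-- If `f` is an integral feasible circulation of `D'` and
`E^(F) = {(vᵢ, vⱼ) ∈ E : f((vᵢᵒᵘᵗ, vⱼⁱⁿ)) = 1}`, then in the directed graph
`(V, E^(F))` every vertex has at most one outgoing edge and at most one incoming
edge. -/
theorem flow_edge_set_in_out_degree_le_one
    {V : Type*} [Fintype V] [DecidableEq V] (E : Finset (V × V)) (S : Finset V)
    (f : Node V → Node V → ℝ)
    (hf : IsFeasibleCirculation E S f) (hint : IsIntegralFlow f) :
    (∀ v w w' : V, (v, w) ∈ E → (v, w') ∈ E →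
        f (.out v) (.inn w) = 1 → f (.out v) (.inn w') = 1 → w = w') ∧
    (∀ v w w' : V, (w, v) ∈ E → (w', v) ∈ E →
        f (.out w) (.inn v) = 1 → f (.out w') (.inn v) = 1 → w = w') := by
  constructor
  · intro v w w' _ _ hw hw'
    exact Node.inn.inj (eq_of_eq_one_of_sum_le_one (g := fun y => f (.out v) y)
      (fun y => hf.nonneg _ y) (hf.sum_from_out_le_one v) hw hw')
  · intro v w w' _ _ hw hw'
    exact Node.out.inj (eq_of_eq_one_of_sum_le_one (g := fun y => f y (.inn v))
      (fun y => hf.nonneg y _) (hf.sum_to_inn_le_one v) hw hw')
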